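/- Monotonicity in k: s_{q^m/q}(k,ρ) ≤ s_{q^m/q}(k+1,ρ) - 1, where s_{q^m/q}(k,ρ) is the minimal F_q-dimension of a rank-ρ-saturating system in F_{q^m}^k. -/

import Mathlib

/-- `U` covers with radius `r`: every vector of `F_{q^m}^k` lies in the `F_{q^m}`-span
of an `F_q`-subspace of `U` of `F_q`-dimension at most `r`. -/
def RkCovers (K : Type*) {L : Type*} [Field K] [Field L] [Algebra K L]
    {ι : Type*} (U : Submodule K (ι → L)) (r : ℕ) : Prop :=
  ∀ v : ι → L, ∃ S : Submodule K (ι → L), S ≤ U ∧ Module.finrank K S ≤ r ∧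
    v ∈ Submodule.span L (S : Set (ι → L))

/-- `U` is rank-`ρ`-saturating: it covers with radius `ρ` and `ρ` is minimal. -/
def IsRankSat (K : Type*) {L : Type*} [Field K] [Field L] [Algebra K L]
    {ι : Type*} (U : Submodule K (ι → L)) (ρ : ℕ) : Prop :=
  RkCovers K U ρ ∧ ∀ r < ρ, ¬ RkCovers K U r

/-- `s_{q^m/q}(k, ρ)`: the minimal `F_q`-dimension of a rank-`ρ`-saturating
`[n,k]_{q^m/q}` system in `F_{q^m}^k`. -/
noncomputable def sMin (K L : Type*) [Field K] [Field L] [Algebra K L] (k ρ : ℕ) : ℕ :=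
  sInf {n : ℕ | ∃ U : Submodule K (Fin k → L),
    Module.finrank K U = n ∧ Submodule.span L (U : Set (Fin k → L)) = ⊤ ∧
      IsRankSat K U ρ}

section helpers

variable {K L : Type*} [Field K] [Field L] [Algebra K L] [Finite K] [Finite L]

lemma RkCovers.mono {ι : Type*} {U : Submodule K (ι → L)} {r s : ℕ} (h : RkCovers K U r)
    (hrs : r ≤ s) : RkCovers K U s := by
  intro v
  obtain ⟨S, h1, h2, h3⟩ := h v
  exact ⟨S, h1, h2.trans hrs, h3⟩

lemma RkCovers.span_top {ι : Type*} {U : Submodule K (ι → L)} {r : ℕ} (h : RkCovers K U r) :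
    Submodule.span L (U : Set (ι → L)) = ⊤ := by
  rw [eq_top_iff]
  intro v _
  obtain ⟨S, h1, h2, h3⟩ := h v
  exact Submodule.span_mono h1 h3

lemma cov_step {k n r : ℕ} (g : Fin n → (Fin k → L)) (i j : Fin n) (hij : i ≠ j) (c : L)
    (h : RkCovers K (Submodule.span K (Set.range g)) r) :
    RkCovers K (Submodule.span K (Set.range (Function.update g j (g j + c • g i)))) (r + 1) := by
  intro v
  obtain ⟨S, h1, h2, h3⟩ := h v
  set g' := Function.update g j (g j + c • g i) with hg'
  let D := Fintype.linearCombination K g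
  let D' := Fintype.linearCombination K g'
  have hD : LinearMap.range D = Submodule.span K (Set.range g) :=
    Fintype.range_linearCombination K g
  have hD' : LinearMap.range D' = Submodule.span K (Set.range g') :=
    Fintype.range_linearCombination K g'
  obtain ⟨sec, hsec⟩ := LinearMap.exists_rightInverse_of_surjective D.rangeRestrict
    (LinearMap.range_rangeRestrict D)
  let hh : S →ₗ[K] (Fin n → K) := sec ∘ₗ Submodule.inclusion (hD ▸ h1)
  have hhD : ∀ x : S, D (hh x) = x := by
    intro x
    have := congrArg Subtype.val (LinearMap.congr_fun hsec (Submodule.inclusion (hD ▸ h1) x))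
    simpa [hh] using this
  have hg'i : g' i = g i := by simp [hg', Function.update_of_ne hij]
  have hDD : ∀ a, D' a = D a + (a j • c) • g i := by
    intro a
    simp only [D, D', Fintype.linearCombination_apply]
    rw [← Finset.add_sum_erase _ _ (Finset.mem_univ j),
      ← Finset.add_sum_erase (a := j) _ (fun x => a x • g x) (Finset.mem_univ j)]
    have : ∑ x ∈ Finset.univ.erase j, a x • g' x = ∑ x ∈ Finset.univ.erase j, a x • g x := by
      apply Finset.sum_congr rfl
      intro x hx
      rw [hg', Function.update_of_ne (Finset.ne_of_mem_erase hx)]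
    rw [this]
    simp only [hg', Function.update_self, smul_add, smul_assoc]
    abel
  refine ⟨LinearMap.range (D' ∘ₗ hh) ⊔ Submodule.span K {g i}, ?_, ?_, ?_⟩
  · apply sup_le
    · rw [← hD']
      exact LinearMap.range_comp_le_range _ _
    · rw [Submodule.span_singleton_le_iff_mem]
      exact Submodule.subset_span ⟨i, hg'i⟩
  · refine (Submodule.finrank_add_le_finrank_add_finrank _ _).trans ?_
    have e1 := LinearMap.finrank_range_le (D' ∘ₗ hh)
    have e2 := finrank_span_le_card (R := K) ({g i} : Set (Fin k → L))
    simp at e2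
    omega
  · refine Submodule.span_le.2 ?_ h3
    intro x hx
    have e := hDD (hh ⟨x, hx⟩)
    rw [hhD] at e
    have e' : x = D' (hh ⟨x, hx⟩) - (hh ⟨x, hx⟩ j • c) • g i := by rw [e]; simp
    rw [e']
    refine sub_mem (Submodule.subset_span ?_) (Submodule.smul_mem _ _ (Submodule.subset_span ?_))
    · exact Submodule.mem_sup_left ⟨_, rfl⟩
    · exact Submodule.mem_sup_right (Submodule.mem_span_singleton_self _)

lemma basis_not_cov {k r : ℕ} {σ : Type*} [Fintype σ] (b : Module.Basis σ L (Fin k → L))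
    (hk : r + 1 ≤ k) (hm : r + 1 ≤ Module.finrank K L) :
    ¬ RkCovers K (Submodule.span K (Set.range b)) r := by
  classical
  intro h
  have hcard : Fintype.card σ = k := by
    rw [← Module.finrank_eq_card_basis b]; simp
  obtain ⟨e⟩ : Nonempty (Fin (r + 1) ↪ σ) :=
    Function.Embedding.nonempty_of_card_le (by simpa [hcard] using hk)
  obtain ⟨μ, hμ⟩ := exists_linearIndependent_of_le_finrank (R := K) (M := L) hm
  obtain ⟨S, h1, h2, h3⟩ := h (∑ i, μ i • b (e i))
  -- coordinates
  let D := Fintype.linearCombination K b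
  have hD : LinearMap.range D = Submodule.span K (Set.range b) :=
    Fintype.range_linearCombination K b
  obtain ⟨sec, hsec⟩ := LinearMap.exists_rightInverse_of_surjective D.rangeRestrict
    (LinearMap.range_rangeRestrict D)
  let hh : S →ₗ[K] (σ → K) := sec ∘ₗ Submodule.inclusion (hD ▸ h1)
  have hhD : ∀ x : S, D (hh x) = x := by
    intro x
    have := congrArg Subtype.val (LinearMap.congr_fun hsec (Submodule.inclusion (hD ▸ h1) x))
    simpa [hh] using this
  let π : (σ → K) →ₗ[K] (Fin (r + 1) → K) := LinearMap.funLeft K K e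
  have hlt : LinearMap.range (π ∘ₗ hh) < ⊤ := by
    rw [lt_top_iff_ne_top]
    intro ht
    have e1 := LinearMap.finrank_range_le (π ∘ₗ hh)
    rw [ht] at e1
    simp at e1
    omega
  obtain ⟨f, hf0, hf⟩ := Submodule.exists_le_ker_of_lt_top _ hlt
  let a : Fin (r + 1) → K := fun i => f (Pi.single i 1)
  have hfa : ∀ x, f x = ∑ i, x i * a i := by
    intro x
    conv_lhs => rw [pi_eq_sum_univ' x]
    simp [a, map_sum]
  let F : (Fin k → L) →ₗ[L] L := ∑ i, algebraMap K L (a i) • b.coord (e i)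
  have hF : ∀ x ∈ S, F x = 0 := by
    intro x hx
    have e1 : f (π (hh ⟨x, hx⟩)) = 0 := hf ⟨_, rfl⟩
    rw [hfa] at e1
    have e2 : ∀ i, b.repr x i = algebraMap K L (hh ⟨x, hx⟩ i) := by
      intro i
      have e3 := hhD ⟨x, hx⟩
      simp only [D, Fintype.linearCombination_apply] at e3
      have e4 : x = ∑ i, (algebraMap K L (hh ⟨x, hx⟩ i)) • b i := by
        refine e3.symm.trans ?_
        simp [algebraMap_smul]
      have e6 := congrArg (fun y => b.repr y i) e4
      simp only [b.repr_sum_self] at e6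
      exact e6
    have e5 := congrArg (algebraMap K L) e1
    simp only [map_sum, map_mul, map_zero] at e5
    simp only [F, LinearMap.sum_apply, LinearMap.smul_apply, Module.Basis.coord_apply, e2,
      smul_eq_mul]
    rw [← e5]
    apply Finset.sum_congr rfl
    intro i _
    rw [mul_comm]; rfl
  have hFv : F (∑ i, μ i • b (e i)) = 0 := by
    have : Submodule.span L (S : Set (Fin k → L)) ≤ LinearMap.ker F :=
      Submodule.span_le.2 fun x hx => hF x hx
    exact this h3
  have hFv' : ∑ i, a i • μ i = 0 := by
    rw [← hFv]
    rw [map_sum]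
    apply Finset.sum_congr rfl
    intro i _
    rw [map_smul]
    simp [F, LinearMap.sum_apply, Finsupp.single_apply, Algebra.smul_def (a i), mul_comm]
  have ha := Fintype.linearIndependent_iff.1 hμ a hFv'
  apply hf0
  refine LinearMap.ext fun x => ?_
  simp [hfa, ha]

lemma exists_sat {k ρ : ℕ} (hρ : 1 ≤ ρ) (hρk : ρ ≤ k) (hρm : ρ ≤ Module.finrank K L)
    (U : Submodule K (Fin k → L)) (hU : RkCovers K U ρ) :
    ∃ U' : Submodule K (Fin k → L), Module.finrank K U' ≤ Module.finrank K U ∧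
      Submodule.span L (U' : Set (Fin k → L)) = ⊤ ∧ IsRankSat K U' ρ := by
  classical
  by_contra hcon
  obtain ⟨r, rfl⟩ : ∃ r, ρ = r + 1 := ⟨ρ - 1, by omega⟩
  set n := Module.finrank K U with hn
  let Q : (Fin n → (Fin k → L)) → Prop := fun g =>
    RkCovers K (Submodule.span K (Set.range g)) (r + 1)
  have hQ : ∀ g, Q g → RkCovers K (Submodule.span K (Set.range g)) r := by
    intro g hg
    by_contra hr
    apply hcon
    refine ⟨Submodule.span K (Set.range g), ?_, hg.span_top, hg, ?_⟩
    · have := finrank_range_le_card (R := K) g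
      simp only [Fintype.card_fin] at this
      exact this
    · intro s hs hs'
      exact hr (hs'.mono (by omega))
  have hstep : ∀ g i j, i ≠ j → ∀ c : L, Q g → Q (Function.update g j (g j + c • g i)) :=
    fun g i j hij c hg => cov_step g i j hij c (hQ g hg)
  have hadd : ∀ g j, ∀ x ∈ Submodule.span L (g '' (Set.univ \ {j})), ∀ y,
      Q (Function.update g j y) → Q (Function.update g j (y + x)) := by
    intro g j x hx
    induction hx using Submodule.closure_induction with
    | zero => intro y hy; simpa using hy
    | add x z _ _ h1 h2 => intro y hy; rw [← add_assoc]; exact h2 _ (h1 _ hy)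
    | smul_mem c x hx =>
      obtain ⟨i, hi, rfl⟩ := hx
      have hij : i ≠ j := by simpa using hi
      intro y hy
      have := hstep _ i j hij c hy
      simpa [Function.update_of_ne hij] using this
  -- start
  have hex : ∃ g, Q g := by
    let b := Module.finBasis K U
    refine ⟨fun i => (b i : Fin k → L), ?_⟩
    have : Submodule.span K (Set.range fun i => (b i : Fin k → L)) = U := by
      have e : (Set.range fun i => (b i : Fin k → L)) = U.subtype '' (Set.range b) := by
        rw [← Set.range_comp]; rfl
      rw [e, Submodule.span_image, b.span_eq]; simp
    show RkCovers K _ _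
    rw [this]; exact hU
  let N : (Fin n → (Fin k → L)) → ℕ := fun g => (Finset.univ.filter fun j => g j ≠ 0).card
  obtain ⟨g, hg, hmin⟩ : ∃ g, Q g ∧ ∀ g', Q g' → N g ≤ N g' := by
    have hne : ({g | Q g}).Nonempty := hex
    refine ⟨Function.argminOn N ({g | Q g}) hne, Function.argminOn_mem N _ hne, ?_⟩
    intro g' hg'
    exact Function.argminOn_le N ({g | Q g}) hg'
  have hnot : ∀ j, g j ≠ 0 → g j ∉ Submodule.span L (g '' (Set.univ \ {j})) := by
    intro j hj hmem
    have h1 := hadd g j _ (neg_mem hmem) (g j) (by simpa using hg)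
    rw [add_neg_cancel] at h1
    refine absurd (hmin _ h1) (not_le.2 ?_)
    apply Finset.card_lt_card
    rw [Finset.ssubset_iff_of_subset]
    · exact ⟨j, by simpa using hj, by simp⟩
    · intro i
      by_cases hij : i = j
      · subst hij; simp
      · simp [Function.update_of_ne hij]
  let b0 : {j // g j ≠ 0} → (Fin k → L) := fun j => g j
  have hli : LinearIndependent L b0 := by
    rw [linearIndependent_iff_notMem_span]
    rintro ⟨j, hj⟩ hmem
    refine hnot j hj (Submodule.span_mono ?_ hmem)
    rintro _ ⟨⟨i, hi⟩, hi', rfl⟩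
    refine ⟨i, ?_, rfl⟩
    simpa using hi'
  have hsp : Submodule.span K (Set.range b0) = Submodule.span K (Set.range g) := by
    apply le_antisymm
    · apply Submodule.span_mono
      rintro _ ⟨i, rfl⟩
      exact ⟨i, rfl⟩
    · rw [Submodule.span_le]
      rintro _ ⟨i, rfl⟩
      by_cases hi : g i = 0
      · rw [hi]; exact zero_mem _
      · exact Submodule.subset_span ⟨⟨i, hi⟩, rfl⟩
  have htop : ⊤ ≤ Submodule.span L (Set.range b0) := by
    have h1 := hg.span_top
    rw [← hsp, Submodule.span_span_of_tower] at h1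
    exact h1.ge
  have hb := basis_not_cov (K := K) (Module.Basis.mk hli htop) hρk hρm
  apply hb
  rw [Module.Basis.coe_mk, hsp]
  exact hQ g hg

end helpers

/-- Monotonicity in `k`: `s_{q^m/q}(k, ρ) ≤ s_{q^m/q}(k+1, ρ) - 1`. -/
theorem sMin_mono_k (K L : Type*) [Field K] [Field L] [Algebra K L]
    [Fintype K] [Fintype L] {k ρ : ℕ}
    (hρ : 1 ≤ ρ) (hρk : ρ ≤ k) (hρm : ρ ≤ Module.finrank K L) :
    sMin K L k ρ ≤ sMin K L (k + 1) ρ - 1 := by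
  have hne : {n : ℕ | ∃ U : Submodule K (Fin (k + 1) → L),
    Module.finrank K U = n ∧ Submodule.span L (U : Set (Fin (k + 1) → L)) = ⊤ ∧
      IsRankSat K U ρ}.Nonempty := by
    have hc : RkCovers K (⊤ : Submodule K (Fin (k + 1) → L)) ρ := by
      intro v
      refine ⟨Submodule.span K {v}, le_top, ?_, ?_⟩
      · have e2 := finrank_span_le_card (R := K) ({v} : Set (Fin (k + 1) → L))
        simp at e2
        omega
      · exact Submodule.subset_span (Submodule.mem_span_singleton_self v)
    obtain ⟨U, -, h2, h3⟩ := exists_sat hρ (by omega) hρm _ hc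
    exact ⟨_, U, rfl, h2, h3⟩
  obtain ⟨U, hU1, hU2, hU3, -⟩ := Nat.sInf_mem hne
  change _ = sMin K L (k + 1) ρ at hU1
  obtain ⟨u, huU, hu0⟩ : ∃ u ∈ U, u ≠ 0 := by
    apply Submodule.exists_mem_ne_zero_of_ne_bot
    rintro rfl
    simp at hU2
  have hfr : Module.finrank L ((Fin (k + 1) → L) ⧸ Submodule.span L {u}) =
      Module.finrank L (Fin k → L) := by
    have h1 := Submodule.finrank_quotient_add_finrank (Submodule.span L {u})
    rw [finrank_span_singleton hu0] at h1
    simp at h1 ⊢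
    exact h1
  let eqv := LinearEquiv.ofFinrankEq _ _ hfr
  let p : (Fin (k + 1) → L) →ₗ[L] (Fin k → L) := eqv.toLinearMap ∘ₗ (Submodule.span L {u}).mkQ
  have hp : Function.Surjective p :=
    eqv.surjective.comp (Submodule.mkQ_surjective _)
  have hpu : p u = 0 := by
    have : (Submodule.span L {u}).mkQ u = 0 := by
      simp [Submodule.mem_span_singleton_self]
    simp [p, this]
  let pK := p.restrictScalars K
  have hcov : RkCovers K (U.map pK) ρ := by
    intro v
    obtain ⟨w, rfl⟩ := hp v
    obtain ⟨S, h1, h2, h3⟩ := hU3 w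
    refine ⟨S.map pK, Submodule.map_mono h1, (Submodule.finrank_map_le _ _).trans h2, ?_⟩
    have : p w ∈ (Submodule.span L (S : Set (Fin (k + 1) → L))).map p :=
      Submodule.mem_map_of_mem h3
    rw [Submodule.map_span] at this
    exact this
  have hdim : Module.finrank K (U.map pK) + 1 ≤ Module.finrank K U := by
    have h1 := LinearMap.finrank_range_add_finrank_ker (pK.domRestrict U)
    rw [LinearMap.range_domRestrict] at h1
    have h2 : 0 < Module.finrank K (LinearMap.ker (pK.domRestrict U)) := by
      rw [Nat.pos_iff_ne_zero]
      intro h0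
      have hb := Submodule.finrank_eq_zero.1 h0
      have hm : (⟨u, huU⟩ : U) ∈ LinearMap.ker (pK.domRestrict U) := hpu
      rw [hb, Submodule.mem_bot] at hm
      exact hu0 (congrArg Subtype.val hm)
    omega
  obtain ⟨U', h1, h2, h3⟩ := exists_sat hρ hρk hρm _ hcov
  have : sMin K L k ρ ≤ Module.finrank K U' := Nat.sInf_le ⟨U', rfl, h2, h3⟩
  omega
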